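/- For every integer k ≥ 1 and all indices A₁, …, A_k, B ∈ {1,…,n} there exist functions r_{Ā₁…Ā_k B}, s_{Ā₁…Ā_k B}, t^{C̄₁…C̄_l E}_{Ā₁…Ā_k B} and u^{C̄₁…C̄_l}_{Ā₁…Ā_k B} (for 1 ≤ l ≤ k−1 and indices C₁,…,C_l, E ∈ {1,…,n}) — each a polynomial in the variables corresponding to conj(L^J γ^C_A) (C, A ∈ {1,…,n}, J ∈ {1,…,n}^t, 0 ≤ t ≤ k−1, where L^J := L_{J₁} ∘ ⋯ ∘ L_{J_t}) with coefficients smooth functions of (x, x̂) ∈ Ω × Ω̂ depending only on the two frames and not on f — such that on Ω: Σ_{D,C₁,…,C_k} γ^D_B·conj(γ^{C₁}_{A₁}) ⋯ conj(γ^{C_k}_{A_k})·(ĥ_{C̄₁…C̄_k D} ∘ f) = r_{Ā₁…Ā_k B}(conj(L^J γ^C_A); f) + ξ·s_{Ā₁…Ā_k B}(conj(L^J γ^C_A); f) + Σ_{l=1}^{k−1} Σ_{E,D,C₁,…,C_l} γ^D_E·(ĥ_{C̄₁…C̄_l D} ∘ f)·t^{C̄₁…C̄_l E}_{Ā₁…Ā_k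 B}(conj(L^J γ^C_A); f) + Σ_{l=1}^{k−1} Σ_{D,C₁,…,C_l} η^D·(ĥ_{C̄₁…C̄_l D} ∘ f)·u^{C̄₁…C̄_l}_{Ā₁…Ā_k B}(conj(L^J γ^C_A); f), where g(conj(L^J γ^C_A); f)(x) denotes the polynomial evaluated at the values conj((L^J γ^C_A)(x)) with coefficients evaluated at (x, f(x)). -/

import Mathlib

open scoped Topology

noncomputable section

/-- A complex vector field on (an open subset of) `ℝ^m`, given by its components:
it acts on functions by `(Xu)(x) = Du(x)·X(x)`. -/
abbrev VF (m : ℕ) := (Fin m → ℝ) → Fin m → ℂ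

/-- The action `(Xu)(x) = Du(x)·X(x)` of a complex vector field on a function. -/
noncomputable def vapp {m : ℕ} (X : VF m) (u : (Fin m → ℝ) → ℂ) (x : Fin m → ℝ) : ℂ :=
  ∑ i, X x i * fderiv ℝ u x (Pi.single i 1)

/-- The Lie bracket `[X,Y](x) = DY(x)·X(x) − DX(x)·Y(x)` of complex vector fields. -/
noncomputable def vbrk {m : ℕ} (X Y : VF m) : VF m :=
  fun x j => vapp X (fun y => Y y j) x - vapp Y (fun y => X y j) x

/-- The componentwise complex conjugate `X̄` of a complex vector field. -/
def vconj {m : ℕ} (X : VF m) : VF m := fun x i => (starRingEnd ℂ) (X x i)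

/-- A normalized frame (Lemma 1.33): `T, L_A, L_Ā` is a smooth pointwise basis of `ℂ^{2n+1}`
on `Ω` with `T` real, `[L_A, L_B] = 0`, `[L_Ā, L_B] = −h_{ĀB}·T`, `[L_Ā, T] = −h_Ā·T`, and
each `[L_A, T]` a smooth multiple of `T`.  The fields `lv` and `hb` are the Levi functions
`h_{ĀB}` and `h_Ā`. -/
structure NFrame (n : ℕ) (Ω : Set (Fin (2 * n + 1) → ℝ)) (T : VF (2 * n + 1))
    (L : Fin n → VF (2 * n + 1))
    (lv : Fin n → Fin n → (Fin (2 * n + 1) → ℝ) → ℂ)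
    (hb : Fin n → (Fin (2 * n + 1) → ℝ) → ℂ) : Prop where
  open_Ω : IsOpen Ω
  mem0 : (0 : Fin (2 * n + 1) → ℝ) ∈ Ω
  smoothT : ContDiffOn ℝ (⊤ : ℕ∞) T Ω
  smoothL : ∀ A, ContDiffOn ℝ (⊤ : ℕ∞) (L A) Ω
  smooth_lv : ∀ A B, ContDiffOn ℝ (⊤ : ℕ∞) (lv A B) Ω
  smooth_hb : ∀ A, ContDiffOn ℝ (⊤ : ℕ∞) (hb A) Ω
  Treal : ∀ x i, (starRingEnd ℂ) (T x i) = T x i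
  indep : ∀ x ∈ Ω, LinearIndependent ℂ
    (Sum.elim (fun _ : Fin 1 => T x) (Sum.elim (fun A => L A x) (fun A => vconj (L A) x)))
  spans : ∀ x ∈ Ω, Submodule.span ℂ
    (Set.range (Sum.elim (fun _ : Fin 1 => T x)
      (Sum.elim (fun A => L A x) (fun A => vconj (L A) x)))) = ⊤
  commLL : ∀ A B, ∀ x ∈ Ω, vbrk (L A) (L B) x = 0
  commLbL : ∀ A B, ∀ x ∈ Ω, vbrk (vconj (L A)) (L B) x = fun i => -(lv A B x) * T x i
  commLbT : ∀ A, ∀ x ∈ Ω, vbrk (vconj (L A)) T x = fun i => -(hb A x) * T x i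
  commLT : ∀ A, ∃ c : (Fin (2 * n + 1) → ℝ) → ℂ, ContDiffOn ℝ (⊤ : ℕ∞) c Ω ∧
    ∀ x ∈ Ω, vbrk (L A) T x = fun i => c x * T x i

/-- Auxiliary: the iterated Levi function `h_{Ā₁…Ā_k}` (`T`-component), with the index list
given in *reverse* order `[A_k,…,A₁]`, defined by the recursion
`h_{Ās C̄} = L_C̄ h_{Ās} + h_{Ās}·h_C̄`. -/
noncomputable def hTrev {n : ℕ} (L : Fin n → VF (2 * n + 1))
    (hb : Fin n → (Fin (2 * n + 1) → ℝ) → ℂ) :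
    List (Fin n) → (Fin (2 * n + 1) → ℝ) → ℂ
  | [] => fun _ => 1
  | [C] => hb C
  | C :: rest => fun x =>
      vapp (vconj (L C)) (hTrev L hb rest) x + hTrev L hb rest x * hb C x

/-- Auxiliary: the iterated Levi function `h_{Ā₁…Ā_k D}`, with the index list given in
*reverse* order `[A_k,…,A₁]`, defined by the recursion
`h_{Ās C̄ D} = L_C̄ h_{Ās D} + h_{Ās}·h_{C̄D}`. -/
noncomputable def hDrev {n : ℕ} (L : Fin n → VF (2 * n + 1))
    (lv : Fin n → Fin n → (Fin (2 * n + 1) → ℝ) → ℂ)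
    (hb : Fin n → (Fin (2 * n + 1) → ℝ) → ℂ) :
    List (Fin n) → Fin n → (Fin (2 * n + 1) → ℝ) → ℂ
  | [], _ => fun _ => 0
  | [C], D => lv C D
  | C :: rest, D => fun x =>
      vapp (vconj (L C)) (hDrev L lv hb rest D) x + hTrev L hb rest x * lv C D x

/-- The iterated Levi function `h_{Ā₁…Ā_k D}`, for `As = [A₁,…,A_k]`. -/
noncomputable def hIt {n : ℕ} (L : Fin n → VF (2 * n + 1))
    (lv : Fin n → Fin n → (Fin (2 * n + 1) → ℝ) → ℂ)
    (hb : Fin n → (Fin (2 * n + 1) → ℝ) → ℂ)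
    (As : List (Fin n)) (D : Fin n) : (Fin (2 * n + 1) → ℝ) → ℂ :=
  hDrev L lv hb As.reverse D

/-- The iterated Levi function `h_{Ā₁…Ā_k}`, for `As = [A₁,…,A_k]`. -/
noncomputable def hTIt {n : ℕ} (L : Fin n → VF (2 * n + 1))
    (hb : Fin n → (Fin (2 * n + 1) → ℝ) → ℂ)
    (As : List (Fin n)) : (Fin (2 * n + 1) → ℝ) → ℂ :=
  hTrev L hb As.reverse

/-- The data of a CR diffeomorphism `f : Ω → Ω̂` expressed in two normalized frames
(Context 10/11/12): `Df·L_B = Σ γ^A_B L̂_A`, `Df·L_B̄ = Σ conj(γ^A_B) L̂_Ā`,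
`Df·T = ξ T̂ + Σ η^A L̂_A + Σ conj(η^A) L̂_Ā`, with `(γ^A_B)` pointwise invertible,
`ξ` real valued, and `f` a smooth diffeomorphism with `f(0) = 0`. -/
structure CRTrans (n : ℕ) (Ω Ωh : Set (Fin (2 * n + 1) → ℝ))
    (T : VF (2 * n + 1)) (L : Fin n → VF (2 * n + 1))
    (Th : VF (2 * n + 1)) (Lh : Fin n → VF (2 * n + 1))
    (f : (Fin (2 * n + 1) → ℝ) → (Fin (2 * n + 1) → ℝ))
    (γ : Fin n → Fin n → (Fin (2 * n + 1) → ℝ) → ℂ)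
    (η : Fin n → (Fin (2 * n + 1) → ℝ) → ℂ)
    (ξ : (Fin (2 * n + 1) → ℝ) → ℝ) : Prop where
  smooth_f : ContDiffOn ℝ (⊤ : ℕ∞) f Ω
  maps : Set.MapsTo f Ω Ωh
  f0 : f 0 = 0
  diffeo : ∃ g, ContDiffOn ℝ (⊤ : ℕ∞) g Ωh ∧ Set.MapsTo g Ωh Ω ∧
    (∀ x ∈ Ω, g (f x) = x) ∧ ∀ y ∈ Ωh, f (g y) = y
  smooth_γ : ∀ A B, ContDiffOn ℝ (⊤ : ℕ∞) (γ A B) Ω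
  smooth_η : ∀ A, ContDiffOn ℝ (⊤ : ℕ∞) (η A) Ω
  smooth_ξ : ContDiffOn ℝ (⊤ : ℕ∞) ξ Ω
  γ_inv : ∀ x ∈ Ω, IsUnit (Matrix.of fun A B => γ A B x)
  pushL : ∀ B, ∀ x ∈ Ω, ∀ j, vapp (L B) (fun y => ((f y j : ℝ) : ℂ)) x =
    ∑ A, γ A B x * Lh A (f x) j
  pushLb : ∀ B, ∀ x ∈ Ω, ∀ j, vapp (vconj (L B)) (fun y => ((f y j : ℝ) : ℂ)) x =
    ∑ A, (starRingEnd ℂ) (γ A B x) * vconj (Lh A) (f x) j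
  pushT : ∀ x ∈ Ω, ∀ j, vapp T (fun y => ((f y j : ℝ) : ℂ)) x =
    (ξ x : ℂ) * Th (f x) j + (∑ A, η A x * Lh A (f x) j)
      + ∑ A, (starRingEnd ℂ) (η A x) * vconj (Lh A) (f x) j

/-- The composition `L^J = L_{J₁} ∘ ⋯ ∘ L_{J_t}` applied to a function, for `J = [J₁,…,J_t]`. -/
noncomputable def appOp {n : ℕ} (L : Fin n → VF (2 * n + 1)) (J : List (Fin n))
    (u : (Fin (2 * n + 1) → ℝ) → ℂ) : (Fin (2 * n + 1) → ℝ) → ℂ :=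
  J.foldr (fun j v => vapp (L j) v) u

/-- Index type of the polynomial variables corresponding to `conj(L^J γ^C_A)` with
`C, A ∈ {1,…,n}` and `|J| ≤ k−1`. -/
abbrev PolyVarγ (n k : ℕ) := Fin n × Fin n × {J : List (Fin n) // J.length ≤ k - 1}

/-- The coefficient ring: functions of `(x, x̂) ∈ ℝ^{2n+1} × ℝ^{2n+1}`. -/
abbrev CoefR (n : ℕ) := ((Fin (2 * n + 1) → ℝ) × (Fin (2 * n + 1) → ℝ)) → ℂ

/-- Evaluation of a polynomial in the variables `conj(L^J γ^C_A)` at the point `x`, the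
coefficients being evaluated at `(x, f(x))`. -/
noncomputable def evalγ {n k : ℕ} (L : Fin n → VF (2 * n + 1))
    (γ : Fin n → Fin n → (Fin (2 * n + 1) → ℝ) → ℂ)
    (f : (Fin (2 * n + 1) → ℝ) → (Fin (2 * n + 1) → ℝ))
    (P : MvPolynomial (PolyVarγ n k) (CoefR n)) (x : Fin (2 * n + 1) → ℝ) : ℂ :=
  MvPolynomial.eval₂ (Pi.evalRingHom (fun _ => ℂ) (x, f x))
    (fun v => (starRingEnd ℂ) (appOp L v.2.2.1 (γ v.1 v.2.1) x)) P

section Calc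
variable {m : ℕ}

lemma vapp_congr (X : VF m) {u v : (Fin m → ℝ) → ℂ} {x : Fin m → ℝ} (h : u =ᶠ[𝓝 x] v) :
    vapp X u x = vapp X v x := by
  unfold vapp; rw [h.fderiv_eq]

lemma vapp_congr_on (X : VF m) {u v : (Fin m → ℝ) → ℂ} {x : Fin m → ℝ}
    {Ω : Set (Fin m → ℝ)} (ho : IsOpen Ω) (hx : x ∈ Ω) (h : ∀ y ∈ Ω, u y = v y) :
    vapp X u x = vapp X v x :=
  vapp_congr X (Filter.eventually_of_mem (ho.mem_nhds hx) h)

lemma vapp_const (X : VF m) (c : ℂ) (x : Fin m → ℝ) : vapp X (fun _ => c) x = 0 := by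
  simp [vapp]

lemma vapp_add (X : VF m) {u v : (Fin m → ℝ) → ℂ} {x : Fin m → ℝ}
    (hu : DifferentiableAt ℝ u x) (hv : DifferentiableAt ℝ v x) :
    vapp X (fun y => u y + v y) x = vapp X u x + vapp X v x := by
  unfold vapp
  rw [fderiv_fun_add hu hv]
  simp [mul_add, Finset.sum_add_distrib]

lemma vapp_mul (X : VF m) {u v : (Fin m → ℝ) → ℂ} {x : Fin m → ℝ}
    (hu : DifferentiableAt ℝ u x) (hv : DifferentiableAt ℝ v x) :
    vapp X (fun y => u y * v y) x = vapp X u x * v x + u x * vapp X v x := by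
  unfold vapp
  rw [fderiv_fun_mul hu hv, Finset.sum_mul, Finset.mul_sum, ← Finset.sum_add_distrib]
  refine Finset.sum_congr rfl fun i _ => ?_
  simp only [_root_.add_apply, _root_.smul_apply, smul_eq_mul]
  ring

lemma vapp_sum (X : VF m) {ι : Type*} (s : Finset ι) {u : ι → (Fin m → ℝ) → ℂ} {x : Fin m → ℝ}
    (hu : ∀ i ∈ s, DifferentiableAt ℝ (u i) x) :
    vapp X (fun y => ∑ i ∈ s, u i y) x = ∑ i ∈ s, vapp X (u i) x := by
  unfold vapp
  rw [fderiv_fun_sum hu, Finset.sum_comm]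
  simp [Finset.mul_sum]

lemma vapp_conj (X : VF m) {u : (Fin m → ℝ) → ℂ} {x : Fin m → ℝ}
    (hu : DifferentiableAt ℝ u x) :
    vapp (vconj X) (fun y => (starRingEnd ℂ) (u y)) x = (starRingEnd ℂ) (vapp X u x) := by
  unfold vapp vconj
  have h : fderiv ℝ (fun y => (starRingEnd ℂ) (u y)) x =
      (Complex.conjCLE : ℂ →L[ℝ] ℂ).comp (fderiv ℝ u x) :=
    ((Complex.conjCLE : ℂ →L[ℝ] ℂ).hasFDerivAt.comp x hu.hasFDerivAt).fderiv
  rw [h]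
  simp

lemma cd_conj {E : Type*} [NormedAddCommGroup E] [NormedSpace ℝ E] {u : E → ℂ} {Ω : Set E}
    (hu : ContDiffOn ℝ (⊤ : ℕ∞) u Ω) :
    ContDiffOn ℝ (⊤ : ℕ∞) (fun y => (starRingEnd ℂ) (u y)) Ω :=
  (Complex.conjCLE : ℂ →L[ℝ] ℂ).contDiff.comp_contDiffOn hu

lemma cd_vconj {X : VF m} {Ω : Set (Fin m → ℝ)}
    (hu : ContDiffOn ℝ (⊤ : ℕ∞) X Ω) : ContDiffOn ℝ (⊤ : ℕ∞) (vconj X) Ω := by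
  rw [contDiffOn_pi] at *
  intro i
  exact cd_conj (hu i)

lemma cd_fderiv {E : Type*} [NormedAddCommGroup E] [NormedSpace ℝ E] {u : E → ℂ}
    {Ω : Set E} (ho : IsOpen Ω)
    (hu : ContDiffOn ℝ (⊤ : ℕ∞) u Ω) (v : E) :
    ContDiffOn ℝ (⊤ : ℕ∞) (fun x => fderiv ℝ u x v) Ω :=
  (hu.fderiv_of_isOpen ho (by simp)).clm_apply contDiffOn_const

lemma cd_vapp {X : VF m} {u : (Fin m → ℝ) → ℂ} {Ω : Set (Fin m → ℝ)} (ho : IsOpen Ω)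
    (hX : ContDiffOn ℝ (⊤ : ℕ∞) X Ω) (hu : ContDiffOn ℝ (⊤ : ℕ∞) u Ω) :
    ContDiffOn ℝ (⊤ : ℕ∞) (vapp X u) Ω := by
  unfold vapp
  refine ContDiffOn.sum fun i _ => ?_
  exact (contDiffOn_pi.1 hX i).mul (cd_fderiv ho hu _)

lemma cd_diffAt {E F : Type*} [NormedAddCommGroup E] [NormedSpace ℝ E]
    [NormedAddCommGroup F] [NormedSpace ℝ F] {u : E → F} {Ω : Set E} (ho : IsOpen Ω)
    (hu : ContDiffOn ℝ (⊤ : ℕ∞) u Ω) {x : E} (hx : x ∈ Ω) : DifferentiableAt ℝ u x :=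
  (hu.contDiffAt (ho.mem_nhds hx)).differentiableAt (by simp)

lemma fderiv_expand {F : Type*} [NormedAddCommGroup F] [NormedSpace ℝ F]
    (φ : (Fin m → ℝ) →L[ℝ] F) (v : Fin m → ℝ) :
    φ v = ∑ j, v j • φ (Pi.single j 1) := by
  conv_lhs => rw [← Finset.univ_sum_single v]
  rw [map_sum]
  refine Finset.sum_congr rfl fun j _ => ?_
  rw [← map_smul]
  congr 1
  ext i
  by_cases h : i = j
  · subst h; simp
  · simp [h]

lemma fderiv_coord {f : (Fin m → ℝ) → (Fin m → ℝ)} {x : Fin m → ℝ}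
    (hf : DifferentiableAt ℝ f x) (v : Fin m → ℝ) (j : Fin m) :
    fderiv ℝ (fun y => ((f y j : ℝ) : ℂ)) x v = ((fderiv ℝ f x v j : ℝ) : ℂ) := by
  have h1 : HasFDerivAt (fun y => f y j)
      ((ContinuousLinearMap.proj j : (Fin m → ℝ) →L[ℝ] ℝ).comp (fderiv ℝ f x)) x :=
    (ContinuousLinearMap.proj j : (Fin m → ℝ) →L[ℝ] ℝ).hasFDerivAt.comp x hf.hasFDerivAt
  have h2 : HasFDerivAt (fun y => ((f y j : ℝ) : ℂ)) _ x := Complex.ofRealCLM.hasFDerivAt.comp x h1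
  rw [h2.fderiv]
  simp

/-- chain rule for a function of `(x, f x)`. -/
lemma vapp_comp2 (X : VF m) {f : (Fin m → ℝ) → (Fin m → ℝ)} {x : Fin m → ℝ}
    {c : (Fin m → ℝ) × (Fin m → ℝ) → ℂ}
    (hf : DifferentiableAt ℝ f x) (hc : DifferentiableAt ℝ c (x, f x)) :
    vapp X (fun y => c (y, f y)) x =
      (∑ i, X x i * fderiv ℝ c (x, f x) (Pi.single i 1, 0)) +
      ∑ j, vapp X (fun y => ((f y j : ℝ) : ℂ)) x * fderiv ℝ c (x, f x) (0, Pi.single j 1) := by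
  have h : HasFDerivAt (fun y => c (y, f y))
      ((fderiv ℝ c (x, f x)).comp ((ContinuousLinearMap.id ℝ _).prod (fderiv ℝ f x))) x :=
    HasFDerivAt.comp x (f := fun y => (y, f y)) hc.hasFDerivAt
      ((hasFDerivAt_id x).prodMk hf.hasFDerivAt)
  have key : ∀ v : Fin m → ℝ, fderiv ℝ (fun y => c (y, f y)) x v =
      fderiv ℝ c (x, f x) (v, 0) +
      ∑ j, fderiv ℝ (fun y => ((f y j : ℝ) : ℂ)) x v * fderiv ℝ c (x, f x) (0, Pi.single j 1) := by
    intro v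
    rw [h.fderiv]
    have e : (v, fderiv ℝ f x v) = (v, (0 : Fin m → ℝ)) + ((0 : Fin m → ℝ), fderiv ℝ f x v) := by
      simp
    simp only [ContinuousLinearMap.comp_apply, ContinuousLinearMap.prod_apply,
      ContinuousLinearMap.id_apply]
    rw [e, map_add]
    congr 1
    have := fderiv_expand ((fderiv ℝ c (x, f x)).comp
      (ContinuousLinearMap.inr ℝ (Fin m → ℝ) (Fin m → ℝ))) (fderiv ℝ f x v)
    simp only [ContinuousLinearMap.comp_apply, ContinuousLinearMap.inr_apply] at this
    rw [this]
    refine Finset.sum_congr rfl fun j _ => ?_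
    rw [fderiv_coord hf]
    simp
  unfold vapp
  simp_rw [key, mul_add, Finset.sum_add_distrib, Finset.mul_sum, Finset.sum_mul]
  congr 1
  rw [Finset.sum_comm]
  simp only [mul_assoc]

lemma vapp_comp (X : VF m) {f : (Fin m → ℝ) → (Fin m → ℝ)} {x : Fin m → ℝ}
    {u : (Fin m → ℝ) → ℂ}
    (hf : DifferentiableAt ℝ f x) (hc : DifferentiableAt ℝ u (f x)) :
    vapp X (fun y => u (f y)) x =
      ∑ j, vapp X (fun y => ((f y j : ℝ) : ℂ)) x * fderiv ℝ u (f x) (Pi.single j 1) := by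
  have h : HasFDerivAt (fun p : (Fin m → ℝ) × (Fin m → ℝ) => u p.2)
      ((fderiv ℝ u (f x)).comp (ContinuousLinearMap.snd ℝ _ _)) (x, f x) :=
    HasFDerivAt.comp (x, f x) (f := Prod.snd) (hc.hasFDerivAt) hasFDerivAt_snd
  have := vapp_comp2 X (c := fun p => u p.2) hf h.differentiableAt
  rw [this, h.fderiv]
  simp

lemma vapp_comp_push (X : VF m) {f : (Fin m → ℝ) → (Fin m → ℝ)} {x : Fin m → ℝ}
    {u : (Fin m → ℝ) → ℂ} {ι : Type*} [Fintype ι] (p : ι → ℂ) (P : ι → VF m)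
    (hf : DifferentiableAt ℝ f x) (hc : DifferentiableAt ℝ u (f x))
    (hp : ∀ j, vapp X (fun y => ((f y j : ℝ) : ℂ)) x = ∑ a, p a * P a (f x) j) :
    vapp X (fun y => u (f y)) x = ∑ a, p a * vapp (P a) u (f x) := by
  rw [vapp_comp X hf hc]
  simp_rw [hp, Finset.sum_mul]
  rw [Finset.sum_comm]
  simp only [vapp, Finset.mul_sum, mul_assoc]

lemma vapp_vbrk {X Y : VF m} {u : (Fin m → ℝ) → ℂ} {Ω : Set (Fin m → ℝ)} (ho : IsOpen Ω)
    (hX : ContDiffOn ℝ (⊤ : ℕ∞) X Ω) (hY : ContDiffOn ℝ (⊤ : ℕ∞) Y Ω)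
    (hu : ContDiffOn ℝ (⊤ : ℕ∞) u Ω) {x : Fin m → ℝ} (hx : x ∈ Ω) :
    vapp (vbrk X Y) u x = vapp X (vapp Y u) x - vapp Y (vapp X u) x := by
  have hsymm : IsSymmSndFDerivAt ℝ u x :=
    (hu.contDiffAt (ho.mem_nhds hx)).isSymmSndFDerivAt
      (by simp only [minSmoothness_of_isRCLikeNormedField]; exact WithTop.coe_le_coe.2 (le_top : (2 : ℕ∞) ≤ ⊤))
  have hdd : DifferentiableAt ℝ (fderiv ℝ u) x :=
    cd_diffAt ho (hu.fderiv_of_isOpen ho (m := (⊤ : ℕ∞)) (by simp)) hx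
  have hsec : ∀ v w, fderiv ℝ (fun y => fderiv ℝ u y v) x w = fderiv ℝ (fderiv ℝ u) x w v := by
    intro v w
    rw [fderiv_clm_apply hdd (differentiableAt_const _)]
    simp
  have main : ∀ X Y : VF m, ContDiffOn ℝ (⊤ : ℕ∞) X Ω → ContDiffOn ℝ (⊤ : ℕ∞) Y Ω →
      vapp X (vapp Y u) x = (∑ i, vapp X (fun y => Y y i) x * fderiv ℝ u x (Pi.single i 1)) +
        ∑ i, ∑ j, Y x i * X x j *
          fderiv ℝ (fderiv ℝ u) x (Pi.single j 1) (Pi.single i 1) := by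
    intro X Y hX hY
    have hYi : ∀ i, DifferentiableAt ℝ (fun y => Y y i) x := fun i =>
      cd_diffAt ho (contDiffOn_pi.1 hY i) hx
    have hui : ∀ i : Fin m, DifferentiableAt ℝ (fun y => fderiv ℝ u y (Pi.single i 1)) x :=
      fun i => cd_diffAt ho (cd_fderiv ho hu _) hx
    have e : vapp Y u = fun y => ∑ i, Y y i * fderiv ℝ u y (Pi.single i 1) := rfl
    rw [e, vapp_sum X Finset.univ (fun i _ => (hYi i).fun_mul (hui i)), ← Finset.sum_add_distrib]
    refine Finset.sum_congr rfl fun i _ => ?_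
    rw [vapp_mul X (hYi i) (hui i)]
    congr 1
    unfold vapp
    rw [Finset.mul_sum]
    refine Finset.sum_congr rfl fun j _ => ?_
    rw [hsec]; ring
  rw [main X Y hX hY, main Y X hY hX]
  have e2 : ∑ i, ∑ j, X x i * Y x j *
          fderiv ℝ (fderiv ℝ u) x (Pi.single j 1) (Pi.single i 1) =
      ∑ i, ∑ j, Y x i * X x j *
          fderiv ℝ (fderiv ℝ u) x (Pi.single j 1) (Pi.single i 1) := by
    rw [Finset.sum_comm]
    refine Finset.sum_congr rfl fun i _ => Finset.sum_congr rfl fun j _ => ?_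
    rw [hsymm.eq (Pi.single i 1) (Pi.single j 1)]; ring
  rw [e2, add_sub_add_right_eq_sub, ← Finset.sum_sub_distrib]
  simp only [← sub_mul]
  rfl

/-- push-forward of a bracket. -/
lemma push_vbrk {X Y : VF m} {f : (Fin m → ℝ) → (Fin m → ℝ)} {Ω Ωh : Set (Fin m → ℝ)}
    (ho : IsOpen Ω) (hoh : IsOpen Ωh) (hf : ContDiffOn ℝ (⊤ : ℕ∞) f Ω) (hm : Set.MapsTo f Ω Ωh)
    (hX : ContDiffOn ℝ (⊤ : ℕ∞) X Ω) (hY : ContDiffOn ℝ (⊤ : ℕ∞) Y Ω)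
    {ι κ : Type*} [Fintype ι] [Fintype κ] (p : ι → (Fin m → ℝ) → ℂ) (P : ι → VF m)
    (q : κ → (Fin m → ℝ) → ℂ) (Q : κ → VF m)
    (hp : ∀ a, ContDiffOn ℝ (⊤ : ℕ∞) (p a) Ω) (hq : ∀ a, ContDiffOn ℝ (⊤ : ℕ∞) (q a) Ω)
    (hP : ∀ a, ContDiffOn ℝ (⊤ : ℕ∞) (P a) Ωh) (hQ : ∀ a, ContDiffOn ℝ (⊤ : ℕ∞) (Q a) Ωh)
    (hXf : ∀ x ∈ Ω, ∀ j, vapp X (fun y => ((f y j : ℝ) : ℂ)) x = ∑ a, p a x * P a (f x) j)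
    (hYf : ∀ x ∈ Ω, ∀ j, vapp Y (fun y => ((f y j : ℝ) : ℂ)) x = ∑ a, q a x * Q a (f x) j)
    {x : Fin m → ℝ} (hx : x ∈ Ω) (j : Fin m) :
    vapp (vbrk X Y) (fun y => ((f y j : ℝ) : ℂ)) x =
      (∑ b, vapp X (q b) x * Q b (f x) j) - (∑ a, vapp Y (p a) x * P a (f x) j)
        + ∑ a, ∑ b, p a x * q b x * vbrk (P a) (Q b) (f x) j := by
  have hfd := cd_diffAt ho hf hx
  have hfj : ContDiffOn ℝ (⊤ : ℕ∞) (fun y => ((f y j : ℝ) : ℂ)) Ω :=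
    Complex.ofRealCLM.contDiff.comp_contDiffOn (contDiffOn_pi.1 hf j)
  have hPj : ∀ a, DifferentiableAt ℝ (fun y => P a y j) (f x) := fun a =>
    cd_diffAt hoh (contDiffOn_pi.1 (hP a) j) (hm hx)
  have hQj : ∀ a, DifferentiableAt ℝ (fun y => Q a y j) (f x) := fun a =>
    cd_diffAt hoh (contDiffOn_pi.1 (hQ a) j) (hm hx)
  have hPf : ∀ a, DifferentiableAt ℝ (fun y => P a (f y) j) x := fun a => (hPj a).comp x hfd
  have hQf : ∀ a, DifferentiableAt ℝ (fun y => Q a (f y) j) x := fun a => (hQj a).comp x hfd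
  have hpd := fun a => cd_diffAt ho (hp a) hx
  have hqd := fun a => cd_diffAt ho (hq a) hx
  rw [vapp_vbrk ho hX hY hfj hx, vapp_congr_on X ho hx (fun y hy => hYf y hy j),
    vapp_congr_on Y ho hx (fun y hy => hXf y hy j),
    vapp_sum X _ (fun b _ => (hqd b).fun_mul (hQf b)), vapp_sum Y _ (fun b _ => (hpd b).fun_mul (hPf b))]
  have e1 : ∀ b, vapp X (fun y => q b y * Q b (f y) j) x = vapp X (q b) x * Q b (f x) j +
      q b x * ∑ a, p a x * vapp (P a) (fun y => Q b y j) (f x) := by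
    intro b
    rw [vapp_mul X (hqd b) (hQf b)]
    rw [vapp_comp_push X (u := fun y => Q b y j) (fun a => p a x) P hfd (hQj b) (hXf x hx)]
  have e2 : ∀ a, vapp Y (fun y => p a y * P a (f y) j) x = vapp Y (p a) x * P a (f x) j +
      p a x * ∑ b, q b x * vapp (Q b) (fun y => P a y j) (f x) := by
    intro a
    rw [vapp_mul Y (hpd a) (hPf a)]
    rw [vapp_comp_push Y (u := fun y => P a y j) (fun a => q a x) Q hfd (hPj a) (hYf x hx)]
  simp_rw [e1, e2, Finset.sum_add_distrib, vbrk, mul_sub, Finset.sum_sub_distrib, Finset.mul_sum]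
  have e3 : ∑ b, ∑ a, q b x * (p a x * vapp (P a) (fun y => Q b y j) (f x)) =
    ∑ a, ∑ b, p a x * q b x * vapp (P a) (fun y => Q b y j) (f x) := by
    rw [Finset.sum_comm]
    refine Finset.sum_congr rfl fun i _ => Finset.sum_congr rfl fun j _ => by ring
  rw [e3]
  simp only [mul_assoc]
  ring

end Calc

section Rel
variable {n : ℕ} {Ω Ωh : Set (Fin (2 * n + 1) → ℝ)}
    {T : VF (2 * n + 1)} {L : Fin n → VF (2 * n + 1)}
    {lv : Fin n → Fin n → (Fin (2 * n + 1) → ℝ) → ℂ}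
    {hb : Fin n → (Fin (2 * n + 1) → ℝ) → ℂ}
    {Th : VF (2 * n + 1)} {Lh : Fin n → VF (2 * n + 1)}
    {lvh : Fin n → Fin n → (Fin (2 * n + 1) → ℝ) → ℂ}
    {hbh : Fin n → (Fin (2 * n + 1) → ℝ) → ℂ}
    {f : (Fin (2 * n + 1) → ℝ) → (Fin (2 * n + 1) → ℝ)}
    {γ : Fin n → Fin n → (Fin (2 * n + 1) → ℝ) → ℂ}
    {η : Fin n → (Fin (2 * n + 1) → ℝ) → ℂ}
    {ξ : (Fin (2 * n + 1) → ℝ) → ℝ}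

lemma frame_coef (hF : NFrame n Ω T L lv hb) {x : Fin (2 * n + 1) → ℝ} (hx : x ∈ Ω)
    (a : ℂ) (b c : Fin n → ℂ)
    (h : ∀ j, a * T x j + (∑ A, b A * L A x j) + (∑ A, c A * vconj (L A) x j) = 0) :
    a = 0 ∧ ∀ A, b A = 0 := by
  have hi := Fintype.linearIndependent_iff.1 (hF.indep x hx)
    (Sum.elim (fun _ => a) (Sum.elim b c)) (by
      funext j
      have := h j
      simp only [Fintype.sum_sum_type, Sum.elim_inl, Sum.elim_inr, Finset.univ_unique,
        Finset.sum_singleton, Pi.add_apply, Pi.smul_apply, Finset.sum_apply, smul_eq_mul,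
        Pi.zero_apply]
      rw [← this]; ring)
  exact ⟨hi (Sum.inl 0), fun A => hi (Sum.inr (Sum.inl A))⟩

lemma vapp_smul_field {m : ℕ} (X Y : VF m) (c : ℂ) (u : (Fin m → ℝ) → ℂ) (x : Fin m → ℝ)
    (h : X x = fun i => c * Y x i) : vapp X u x = c * vapp Y u x := by
  unfold vapp
  rw [h, Finset.mul_sum]
  simp only [mul_assoc]

lemma rel1 (hF : NFrame n Ω T L lv hb) (hFh : NFrame n Ωh Th Lh lvh hbh)
    (hC : CRTrans n Ω Ωh T L Th Lh f γ η ξ) {x : Fin (2 * n + 1) → ℝ} (hx : x ∈ Ω)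
    (A B : Fin n) :
    (∑ C, ∑ D, (starRingEnd ℂ) (γ C A x) * γ D B x * lvh C D (f x) = ξ x * lv A B x) ∧
    ∀ D, vapp (vconj (L A)) (γ D B) x = - lv A B x * η D x := by
  have key := fun j => push_vbrk hF.open_Ω hFh.open_Ω hC.smooth_f hC.maps
    (cd_vconj (hF.smoothL A)) (hF.smoothL B)
    (fun C y => (starRingEnd ℂ) (γ C A y)) (fun C => vconj (Lh C)) (fun D => γ D B) Lh
    (fun C => cd_conj (hC.smooth_γ C A)) (fun D => hC.smooth_γ D B)
    (fun C => cd_vconj (hFh.smoothL C)) hFh.smoothL (hC.pushLb A) (hC.pushL B) hx j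
  have h2 := frame_coef hFh (hC.maps hx)
    (- (∑ C, ∑ D, (starRingEnd ℂ) (γ C A x) * γ D B x * lvh C D (f x)) + ξ x * lv A B x)
    (fun D => vapp (vconj (L A)) (γ D B) x + lv A B x * η D x)
    (fun C => - vapp (L B) (fun y => (starRingEnd ℂ) (γ C A y)) x
      + lv A B x * (starRingEnd ℂ) (η C x)) (by
      intro j
      have k1 := key j
      rw [vapp_smul_field _ T _ _ x (hF.commLbL A B x hx), hC.pushT x hx j] at k1
      have e : ∀ C D, vbrk (vconj (Lh C)) (Lh D) (f x) j = - lvh C D (f x) * Th (f x) j :=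
        fun C D => congrFun (hFh.commLbL C D (f x) (hC.maps hx)) j
      simp only [e] at k1
      simp only [add_mul, Finset.sum_add_distrib, neg_mul, Finset.sum_neg_distrib, mul_neg,
        mul_assoc, mul_add, ← Finset.mul_sum, Finset.sum_mul] at k1 ⊢
      linear_combination -k1)
  refine ⟨?_, fun D => ?_⟩
  · linear_combination -h2.1
  · linear_combination h2.2 D

lemma rel2 (hF : NFrame n Ω T L lv hb) (hFh : NFrame n Ωh Th Lh lvh hbh)
    (hC : CRTrans n Ω Ωh T L Th Lh f γ η ξ) {x : Fin (2 * n + 1) → ℝ} (hx : x ∈ Ω)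
    (A : Fin n) :
    (vapp (vconj (L A)) (fun y => (ξ y : ℂ)) x =
      ξ x * ((∑ C, (starRingEnd ℂ) (γ C A x) * hbh C (f x)) - hb A x) +
      ∑ C, ∑ D, η D x * lvh C D (f x) * (starRingEnd ℂ) (γ C A x)) ∧
    ∀ D, vapp (vconj (L A)) (η D) x = - hb A x * η D x := by
  have hξ : ContDiffOn ℝ (⊤ : ℕ∞) (fun y => (ξ y : ℂ)) Ω :=
    Complex.ofRealCLM.contDiff.comp_contDiffOn hC.smooth_ξ
  have key := fun j => push_vbrk hF.open_Ω hFh.open_Ω hC.smooth_f hC.maps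
    (cd_vconj (hF.smoothL A)) hF.smoothT
    (fun C y => (starRingEnd ℂ) (γ C A y)) (fun C => vconj (Lh C))
    (Sum.elim (fun (_ : Fin 1) y => (ξ y : ℂ))
      (Sum.elim η (fun (D : Fin n) y => (starRingEnd ℂ) (η D y))))
    (Sum.elim (fun (_ : Fin 1) => Th) (Sum.elim Lh (fun D : Fin n => vconj (Lh D))))
    (fun C => cd_conj (hC.smooth_γ C A))
    (by rintro (a | a | a)
        · exact hξ
        · exact hC.smooth_η a
        · exact cd_conj (hC.smooth_η a))
    (fun C => cd_vconj (hFh.smoothL C))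
    (by rintro (a | a | a)
        · exact hFh.smoothT
        · exact hFh.smoothL a
        · exact cd_vconj (hFh.smoothL a)) (hC.pushLb A)
    (by intro x hx j
        rw [hC.pushT x hx j]
        simp [Fintype.sum_sum_type, add_assoc]) hx j
  have h2 := frame_coef hFh (hC.maps hx)
    (vapp (vconj (L A)) (fun y => (ξ y : ℂ)) x -
      ξ x * ((∑ C, (starRingEnd ℂ) (γ C A x) * hbh C (f x)) - hb A x) -
      ∑ C, ∑ D, η D x * lvh C D (f x) * (starRingEnd ℂ) (γ C A x))
    (fun D => vapp (vconj (L A)) (η D) x + hb A x * η D x)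
    (fun C => vapp (vconj (L A)) (fun y => (starRingEnd ℂ) (η C y)) x -
      vapp T (fun y => (starRingEnd ℂ) (γ C A y)) x
      + hb A x * (starRingEnd ℂ) (η C x)) (by
      intro j
      have k1 := key j
      rw [vapp_smul_field _ T _ _ x (hF.commLbT A x hx), hC.pushT x hx j] at k1
      have e : ∀ C D, vbrk (vconj (Lh C)) (Lh D) (f x) j = - lvh C D (f x) * Th (f x) j :=
        fun C D => congrFun (hFh.commLbL C D (f x) (hC.maps hx)) j
      have e' : ∀ C, vbrk (vconj (Lh C)) Th (f x) j = - hbh C (f x) * Th (f x) j :=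
        fun C => congrFun (hFh.commLbT C (f x) (hC.maps hx)) j
      have e'' : ∀ C D, vbrk (vconj (Lh C)) (vconj (Lh D)) (f x) j = 0 := by
        intro C D
        have h := congrFun (hFh.commLL C D (f x) (hC.maps hx)) j
        have hd : ∀ C, DifferentiableAt ℝ (fun y => Lh C y j) (f x) := fun C =>
          cd_diffAt hFh.open_Ω (contDiffOn_pi.1 (hFh.smoothL C) j) (hC.maps hx)
        have h' := congrArg (starRingEnd ℂ) h
        simp only [vbrk, map_sub, Pi.zero_apply, map_zero] at h'
        rw [← vapp_conj _ (hd D), ← vapp_conj _ (hd C)] at h'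
        exact h'
      simp only [Fintype.sum_sum_type, Sum.elim_inl, Sum.elim_inr, Finset.univ_unique,
        Finset.sum_singleton, e, e', e''] at k1
      have s1 : ∀ C, ∑ D, (starRingEnd ℂ) (γ C A x) * η D x * (-lvh C D (f x) * Th (f x) j) =
        - (∑ D, η D x * lvh C D (f x) * (starRingEnd ℂ) (γ C A x)) * Th (f x) j := by
        intro C
        rw [neg_mul, Finset.sum_mul, ← Finset.sum_neg_distrib]
        exact Finset.sum_congr rfl fun D _ => by ring
      have s2 : ∑ C, (starRingEnd ℂ) (γ C A x) * (ξ x : ℂ) * (-hbh C (f x) * Th (f x) j) =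
        - (ξ x * (∑ C, (starRingEnd ℂ) (γ C A x) * hbh C (f x))) * Th (f x) j := by
        rw [neg_mul, Finset.mul_sum, Finset.sum_mul, ← Finset.sum_neg_distrib]
        exact Finset.sum_congr rfl fun D _ => by ring
      simp only [s1, Finset.sum_add_distrib, s2, mul_zero, Finset.sum_const_zero, add_zero] at k1
      simp only [sub_mul, add_mul, Finset.sum_add_distrib, Finset.sum_sub_distrib, neg_mul,
        Finset.sum_neg_distrib, mul_neg, mul_assoc, mul_add, ← Finset.mul_sum, mul_sub,
        ← Finset.sum_mul] at k1 ⊢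
      linear_combination -k1)
  refine ⟨?_, fun D => ?_⟩
  · linear_combination h2.1
  · linear_combination h2.2 D

end Rel

structure Dat (n : ℕ) where
  f : (Fin (2 * n + 1) → ℝ) → (Fin (2 * n + 1) → ℝ)
  γ : Fin n → Fin n → (Fin (2 * n + 1) → ℝ) → ℂ
  η : Fin n → (Fin (2 * n + 1) → ℝ) → ℂ
  ξ : (Fin (2 * n + 1) → ℝ) → ℝ

def Vd {n : ℕ} (Ω Ωh : Set (Fin (2 * n + 1) → ℝ))
    (T : VF (2 * n + 1)) (L : Fin n → VF (2 * n + 1))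
    (Th : VF (2 * n + 1)) (Lh : Fin n → VF (2 * n + 1)) (d : Dat n) : Prop :=
  CRTrans n Ω Ωh T L Th Lh d.f d.γ d.η d.ξ

inductive GG {n : ℕ} (Ω Ωh : Set (Fin (2 * n + 1) → ℝ))
    (T : VF (2 * n + 1)) (L : Fin n → VF (2 * n + 1))
    (Th : VF (2 * n + 1)) (Lh : Fin n → VF (2 * n + 1)) (k : ℕ) :
    (Dat n → (Fin (2 * n + 1) → ℝ) → ℂ) → Prop
  | coef (c : CoefR n) (hc : ContDiffOn ℝ (⊤ : ℕ∞) c (Ω ×ˢ Ωh)) :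
      GG Ω Ωh T L Th Lh k (fun d x => c (x, d.f x))
  | var (C A : Fin n) (J : List (Fin n)) (hJ : J.length ≤ k - 1) :
      GG Ω Ωh T L Th Lh k (fun d x => (starRingEnd ℂ) (appOp L J (d.γ C A) x))
  | add (F F' : Dat n → (Fin (2 * n + 1) → ℝ) → ℂ) (h : GG Ω Ωh T L Th Lh k F)
      (h' : GG Ω Ωh T L Th Lh k F') : GG Ω Ωh T L Th Lh k (fun d x => F d x + F' d x)
  | mul (F F' : Dat n → (Fin (2 * n + 1) → ℝ) → ℂ) (h : GG Ω Ωh T L Th Lh k F)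
      (h' : GG Ω Ωh T L Th Lh k F') : GG Ω Ωh T L Th Lh k (fun d x => F d x * F' d x)
  | congr (F F' : Dat n → (Fin (2 * n + 1) → ℝ) → ℂ) (h : GG Ω Ωh T L Th Lh k F)
      (h' : ∀ d, Vd Ω Ωh T L Th Lh d → ∀ x ∈ Ω, F' d x = F d x) : GG Ω Ωh T L Th Lh k F'

inductive WW {n : ℕ} (Ω Ωh : Set (Fin (2 * n + 1) → ℝ))
    (T : VF (2 * n + 1)) (L : Fin n → VF (2 * n + 1))
    (Th : VF (2 * n + 1)) (Lh : Fin n → VF (2 * n + 1))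
    (lvh : Fin n → Fin n → (Fin (2 * n + 1) → ℝ) → ℂ)
    (hbh : Fin n → (Fin (2 * n + 1) → ℝ) → ℂ) (k : ℕ) :
    (Dat n → (Fin (2 * n + 1) → ℝ) → ℂ) → Prop
  | xi (s : Dat n → (Fin (2 * n + 1) → ℝ) → ℂ) (hs : GG Ω Ωh T L Th Lh k s) :
      WW Ω Ωh T L Th Lh lvh hbh k (fun d x => (d.ξ x : ℂ) * s d x)
  | gam (Cs : List (Fin n)) (h1 : 1 ≤ Cs.length) (h2 : Cs.length ≤ k - 1) (E : Fin n)
      (t : Dat n → (Fin (2 * n + 1) → ℝ) → ℂ) (ht : GG Ω Ωh T L Th Lh k t) :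
      WW Ω Ωh T L Th Lh lvh hbh k
        (fun d x => ∑ D, d.γ D E x * hDrev Lh lvh hbh Cs D (d.f x) * t d x)
  | eta (Cs : List (Fin n)) (h1 : 1 ≤ Cs.length) (h2 : Cs.length ≤ k - 1)
      (t : Dat n → (Fin (2 * n + 1) → ℝ) → ℂ) (ht : GG Ω Ωh T L Th Lh k t) :
      WW Ω Ωh T L Th Lh lvh hbh k
        (fun d x => ∑ D, d.η D x * hDrev Lh lvh hbh Cs D (d.f x) * t d x)
  | add (F F' : Dat n → (Fin (2 * n + 1) → ℝ) → ℂ) (h : WW Ω Ωh T L Th Lh lvh hbh k F)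
      (h' : WW Ω Ωh T L Th Lh lvh hbh k F') :
      WW Ω Ωh T L Th Lh lvh hbh k (fun d x => F d x + F' d x)
  | congr (F F' : Dat n → (Fin (2 * n + 1) → ℝ) → ℂ) (h : WW Ω Ωh T L Th Lh lvh hbh k F)
      (h' : ∀ d, Vd Ω Ωh T L Th Lh d → ∀ x ∈ Ω, F' d x = F d x) :
      WW Ω Ωh T L Th Lh lvh hbh k F'

section Main
variable {n : ℕ} {Ω Ωh : Set (Fin (2 * n + 1) → ℝ)}
    {T : VF (2 * n + 1)} {L : Fin n → VF (2 * n + 1)}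
    {lv : Fin n → Fin n → (Fin (2 * n + 1) → ℝ) → ℂ}
    {hb : Fin n → (Fin (2 * n + 1) → ℝ) → ℂ}
    {Th : VF (2 * n + 1)} {Lh : Fin n → VF (2 * n + 1)}
    {lvh : Fin n → Fin n → (Fin (2 * n + 1) → ℝ) → ℂ}
    {hbh : Fin n → (Fin (2 * n + 1) → ℝ) → ℂ} {k : ℕ}

lemma GG.const (c : ℂ) : GG Ω Ωh T L Th Lh k (fun _ _ => c) :=
  GG.coef (fun _ => c) contDiffOn_const

lemma GG.fst {u : (Fin (2 * n + 1) → ℝ) → ℂ} (hu : ContDiffOn ℝ (⊤ : ℕ∞) u Ω) :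
    GG Ω Ωh T L Th Lh k (fun _ x => u x) :=
  GG.coef (fun p => u p.1) (hu.comp contDiffOn_fst (fun _ hp => hp.1))

lemma GG.snd {u : (Fin (2 * n + 1) → ℝ) → ℂ} (hu : ContDiffOn ℝ (⊤ : ℕ∞) u Ωh) :
    GG Ω Ωh T L Th Lh k (fun d x => u (d.f x)) :=
  GG.coef (fun p => u p.2) (hu.comp contDiffOn_snd (fun _ hp => hp.2))

lemma GG.cg (C A : Fin n) :
    GG Ω Ωh T L Th Lh k (fun d x => (starRingEnd ℂ) (d.γ C A x)) :=
  GG.var C A [] (by simp)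

lemma GG.neg {F : Dat n → (Fin (2 * n + 1) → ℝ) → ℂ} (h : GG Ω Ωh T L Th Lh k F) :
    GG Ω Ωh T L Th Lh k (fun d x => - F d x) :=
  GG.congr _ _ (GG.mul _ _ (GG.const (-1)) h) (fun d _ x _ => by simp)

lemma GG.sum {ι : Type*} (s : Finset ι) {F : ι → Dat n → (Fin (2 * n + 1) → ℝ) → ℂ}
    (h : ∀ i, GG Ω Ωh T L Th Lh k (F i)) :
    GG Ω Ωh T L Th Lh k (fun d x => ∑ i ∈ s, F i d x) := by
  classical
  induction s using Finset.induction_on with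
  | empty => simpa using GG.const 0
  | insert a s ha ih => simpa [Finset.sum_insert ha] using GG.add _ _ (h a) ih

lemma GG.prod {ι : Type*} (s : Finset ι) {F : ι → Dat n → (Fin (2 * n + 1) → ℝ) → ℂ}
    (h : ∀ i, GG Ω Ωh T L Th Lh k (F i)) :
    GG Ω Ωh T L Th Lh k (fun d x => ∏ i ∈ s, F i d x) := by
  classical
  induction s using Finset.induction_on with
  | empty => simpa using GG.const 1
  | insert a s ha ih => simpa [Finset.prod_insert ha] using GG.mul _ _ (h a) ih

lemma GG.mono {F : Dat n → (Fin (2 * n + 1) → ℝ) → ℂ} (h : GG Ω Ωh T L Th Lh k F) :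
    GG Ω Ωh T L Th Lh (k + 1) F := by
  induction h with
  | coef c hc => exact GG.coef c hc
  | var C A J hJ => exact GG.var C A J (by omega)
  | add F F' _ _ h h' => exact GG.add _ _ h h'
  | mul F F' _ _ h h' => exact GG.mul _ _ h h'
  | congr F F' _ h' h => exact GG.congr _ _ h h'

lemma cd_appOp (hF : NFrame n Ω T L lv hb) (J : List (Fin n))
    {u : (Fin (2 * n + 1) → ℝ) → ℂ} (hu : ContDiffOn ℝ (⊤ : ℕ∞) u Ω) :
    ContDiffOn ℝ (⊤ : ℕ∞) (appOp L J u) Ω := by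
  induction J with
  | nil => exact hu
  | cons a J ih => exact cd_vapp hF.open_Ω (hF.smoothL a) ih

lemma GG.smooth (hF : NFrame n Ω T L lv hb)
    {F : Dat n → (Fin (2 * n + 1) → ℝ) → ℂ} (h : GG Ω Ωh T L Th Lh k F) (d : Dat n)
    (hd : Vd Ω Ωh T L Th Lh d) : ContDiffOn ℝ (⊤ : ℕ∞) (F d) Ω := by
  induction h with
  | coef c hc =>
    exact hc.comp (contDiffOn_id.prodMk hd.smooth_f) (fun x hx => ⟨hx, hd.maps hx⟩)
  | var C A J hJ => exact cd_conj (cd_appOp hF J (hd.smooth_γ C A))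
  | add F F' _ _ h h' => exact h.add h'
  | mul F F' _ _ h h' => exact h.mul h'
  | congr F F' _ h' h => exact h.congr (fun x hx => h' d hd x hx)

lemma GG.deriv (hF : NFrame n Ω T L lv hb) (hFh : NFrame n Ωh Th Lh lvh hbh) (hk : 1 ≤ k)
    (A : Fin n)
    {F : Dat n → (Fin (2 * n + 1) → ℝ) → ℂ} (h : GG Ω Ωh T L Th Lh k F) :
    GG Ω Ωh T L Th Lh (k + 1) (fun d => vapp (vconj (L A)) (F d)) := by
  induction h with
  | coef c hc =>
    have ho : IsOpen (Ω ×ˢ Ωh) := hF.open_Ω.prod hFh.open_Ω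
    have h1 : ∀ v, ContDiffOn ℝ (⊤ : ℕ∞) (fun p => fderiv ℝ c p v) (Ω ×ˢ Ωh) :=
      fun v => cd_fderiv ho hc v
    refine GG.congr _ _ (GG.add _ _
      (GG.coef (fun p => ∑ i, vconj (L A) p.1 i * fderiv ℝ c p (Pi.single i 1, 0)) ?_)
      (GG.sum Finset.univ (fun C => GG.mul _ _ (GG.cg C A)
        (GG.coef (fun p => ∑ j, vconj (Lh C) p.2 j * fderiv ℝ c p (0, Pi.single j 1)) ?_)))) ?_
    · refine ContDiffOn.sum fun i _ => ContDiffOn.mul ?_ (h1 _)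
      exact (contDiffOn_pi.1 (cd_vconj (hF.smoothL A)) i).comp contDiffOn_fst (fun _ hp => hp.1)
    · refine ContDiffOn.sum fun i _ => ContDiffOn.mul ?_ (h1 _)
      exact (contDiffOn_pi.1 (cd_vconj (hFh.smoothL C)) i).comp contDiffOn_snd (fun _ hp => hp.2)
    · intro d hd x hx
      have hfd := cd_diffAt hF.open_Ω hd.smooth_f hx
      rw [vapp_comp2 _ hfd (cd_diffAt ho hc ⟨hx, hd.maps hx⟩)]
      congr 1
      simp_rw [hd.pushLb A x hx, Finset.sum_mul, Finset.mul_sum]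
      rw [Finset.sum_comm]
      simp only [mul_assoc]
  | var C B J hJ =>
    refine GG.congr _ _ (GG.var C B (A :: J) (by simp; omega)) ?_
    intro d hd x hx
    exact vapp_conj (L A) (cd_diffAt hF.open_Ω (cd_appOp hF J (hd.smooth_γ C B)) hx)
  | add F F' g g' h h' =>
    refine GG.congr _ _ (GG.add _ _ h h') ?_
    intro d hd x hx
    exact vapp_add _ (cd_diffAt hF.open_Ω (g.smooth hF d hd) hx)
      (cd_diffAt hF.open_Ω (g'.smooth hF d hd) hx)
  | mul F F' g g' h h' =>
    refine GG.congr _ _ (GG.add _ _ (GG.mul _ _ h g'.mono) (GG.mul _ _ g.mono h')) ?_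
    intro d hd x hx
    exact vapp_mul _ (cd_diffAt hF.open_Ω (g.smooth hF d hd) hx)
      (cd_diffAt hF.open_Ω (g'.smooth hF d hd) hx)
  | congr F F' _ h' h =>
    refine GG.congr _ _ h ?_
    intro d hd x hx
    exact vapp_congr_on _ hF.open_Ω hx (h' d hd)

def SmP (Ω Ωh : Set (Fin (2 * n + 1) → ℝ)) (P : MvPolynomial (PolyVarγ n k) (CoefR n)) : Prop :=
  ∀ d, ContDiffOn ℝ (⊤ : ℕ∞) (MvPolynomial.coeff d P) (Ω ×ˢ Ωh)

lemma SmP.zero : SmP Ω Ωh (0 : MvPolynomial (PolyVarγ n k) (CoefR n)) := by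
  intro d
  rw [MvPolynomial.coeff_zero]
  exact contDiffOn_const

lemma SmP.add {P Q : MvPolynomial (PolyVarγ n k) (CoefR n)} (hP : SmP Ω Ωh P)
    (hQ : SmP Ω Ωh Q) : SmP Ω Ωh (P + Q) := by
  intro d
  rw [MvPolynomial.coeff_add]
  exact (hP d).add (hQ d)

lemma SmP.ite (p : Prop) [Decidable p] {P : MvPolynomial (PolyVarγ n k) (CoefR n)}
    (hP : SmP Ω Ωh P) : SmP Ω Ωh (if p then P else 0) := by
  split_ifs
  · exact hP
  · exact SmP.zero

lemma SmP.mul {P Q : MvPolynomial (PolyVarγ n k) (CoefR n)} (hP : SmP Ω Ωh P)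
    (hQ : SmP Ω Ωh Q) : SmP Ω Ωh (P * Q) := by
  classical
  intro d
  rw [MvPolynomial.coeff_mul, Finset.sum_fn]
  exact ContDiffOn.sum fun i _ => (hP _).mul (hQ _)

lemma GG.poly {F : Dat n → (Fin (2 * n + 1) → ℝ) → ℂ} (h : GG Ω Ωh T L Th Lh k F) :
    ∃ P : MvPolynomial (PolyVarγ n k) (CoefR n), SmP Ω Ωh P ∧
      ∀ d, Vd Ω Ωh T L Th Lh d → ∀ x ∈ Ω, evalγ L d.γ d.f P x = F d x := by
  classical
  induction h with
  | coef c hc =>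
    refine ⟨MvPolynomial.C c, ?_, ?_⟩
    · intro d
      rw [MvPolynomial.coeff_C]
      split_ifs
      · exact hc
      · exact contDiffOn_const
    · intro d _ x _
      simp [evalγ]
  | var C A J hJ =>
    refine ⟨MvPolynomial.X (C, A, ⟨J, hJ⟩), ?_, ?_⟩
    · intro d
      rw [MvPolynomial.coeff_X]
      split_ifs
      · exact contDiffOn_const
      · exact contDiffOn_const
    · intro d _ x _
      simp [evalγ]
  | add F F' _ _ h h' =>
    obtain ⟨P, hP, e⟩ := h
    obtain ⟨P', hP', e'⟩ := h'
    refine ⟨P + P', hP.add hP', fun d hd x hx => ?_⟩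
    beta_reduce
    rw [← e d hd x hx, ← e' d hd x hx]
    simp [evalγ]
  | mul F F' _ _ h h' =>
    obtain ⟨P, hP, e⟩ := h
    obtain ⟨P', hP', e'⟩ := h'
    refine ⟨P * P', hP.mul hP', fun d hd x hx => ?_⟩
    beta_reduce
    rw [← e d hd x hx, ← e' d hd x hx]
    simp [evalγ]
  | congr F F' _ h' h =>
    obtain ⟨P, hP, e⟩ := h
    exact ⟨P, hP, fun d hd x hx => by rw [e d hd x hx, h' d hd x hx]⟩

lemma cd_hTrev (hF : NFrame n Ω T L lv hb) : ∀ (J : List (Fin n)),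
    ContDiffOn ℝ (⊤ : ℕ∞) (hTrev L hb J) Ω
  | [] => contDiffOn_const
  | [C] => hF.smooth_hb C
  | C :: C' :: rest =>
    (cd_vapp hF.open_Ω (cd_vconj (hF.smoothL C)) (cd_hTrev hF (C' :: rest))).add
      ((cd_hTrev hF (C' :: rest)).mul (hF.smooth_hb C))

lemma cd_hDrev (hF : NFrame n Ω T L lv hb) (D : Fin n) : ∀ (J : List (Fin n)),
    ContDiffOn ℝ (⊤ : ℕ∞) (hDrev L lv hb J D) Ω
  | [] => contDiffOn_const
  | [C] => hF.smooth_lv C D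
  | C :: C' :: rest =>
    (cd_vapp hF.open_Ω (cd_vconj (hF.smoothL C)) (cd_hDrev hF D (C' :: rest))).add
      ((cd_hTrev hF (C' :: rest)).mul (hF.smooth_lv C D))

lemma hDrev_cons (C D : Fin n) (Cs : List (Fin n)) (h : 1 ≤ Cs.length)
    (y : Fin (2 * n + 1) → ℝ) :
    hDrev L lv hb (C :: Cs) D y =
      vapp (vconj (L C)) (hDrev L lv hb Cs D) y + hTrev L hb Cs y * lv C D y := by
  match Cs, h with
  | C' :: rest, _ => rfl

lemma deriv_term (hF : NFrame n Ω T L lv hb) (hFh : NFrame n Ωh Th Lh lvh hbh)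
    (A : Fin n) (d : Dat n) (hd : Vd Ω Ωh T L Th Lh d) (a : Fin n → (Fin (2 * n + 1) → ℝ) → ℂ)
    (ha : ∀ D, ContDiffOn ℝ (⊤ : ℕ∞) (a D) Ω) (t : (Fin (2 * n + 1) → ℝ) → ℂ)
    (ht : ContDiffOn ℝ (⊤ : ℕ∞) t Ω) (Cs : List (Fin n)) (h1 : 1 ≤ Cs.length)
    {x : Fin (2 * n + 1) → ℝ} (hx : x ∈ Ω) :
    vapp (vconj (L A)) (fun x => ∑ D, a D x * hDrev Lh lvh hbh Cs D (d.f x) * t x) x =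
      (∑ C, ∑ D, a D x * hDrev Lh lvh hbh (C :: Cs) D (d.f x) *
        ((starRingEnd ℂ) (d.γ C A x) * t x)) +
      ((∑ C, ∑ D, a D x * hDrev Lh lvh hbh [C] D (d.f x) *
        (-((starRingEnd ℂ) (d.γ C A x) * (hTrev Lh hbh Cs (d.f x) * t x)))) +
      ((∑ D, a D x * hDrev Lh lvh hbh Cs D (d.f x) * vapp (vconj (L A)) t x) +
      (∑ D, vapp (vconj (L A)) (a D) x * hDrev Lh lvh hbh Cs D (d.f x) * t x))) := by
  have hfd := cd_diffAt hF.open_Ω hd.smooth_f hx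
  have had := fun D => cd_diffAt hF.open_Ω (ha D) hx
  have htd := cd_diffAt hF.open_Ω ht hx
  have hhd := fun D => cd_diffAt hFh.open_Ω (cd_hDrev hFh D Cs) (hd.maps hx)
  have hhf : ∀ D, DifferentiableAt ℝ (fun y => hDrev Lh lvh hbh Cs D (d.f y)) x :=
    fun D => (hhd D).comp x hfd
  rw [vapp_sum _ _ (fun D _ => ((had D).fun_mul (hhf D)).fun_mul htd)]
  have e : ∀ D, vapp (vconj (L A)) (fun x => a D x * hDrev Lh lvh hbh Cs D (d.f x) * t x) x =
      (∑ C, a D x * hDrev Lh lvh hbh (C :: Cs) D (d.f x) *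
        ((starRingEnd ℂ) (d.γ C A x) * t x)) +
      ((∑ C, a D x * hDrev Lh lvh hbh [C] D (d.f x) *
        (-((starRingEnd ℂ) (d.γ C A x) * (hTrev Lh hbh Cs (d.f x) * t x)))) +
      ((a D x * hDrev Lh lvh hbh Cs D (d.f x) * vapp (vconj (L A)) t x) +
      (vapp (vconj (L A)) (a D) x * hDrev Lh lvh hbh Cs D (d.f x) * t x))) := by
    intro D
    rw [vapp_mul _ ((had D).fun_mul (hhf D)) htd, vapp_mul _ (had D) (hhf D),
      vapp_comp_push _ (u := hDrev Lh lvh hbh Cs D) (fun C => (starRingEnd ℂ) (d.γ C A x))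
        (fun C => vconj (Lh C)) hfd (hhd D) (hd.pushLb A x hx)]
    have e2 : (∑ C, (starRingEnd ℂ) (d.γ C A x) *
        vapp (vconj (Lh C)) (hDrev Lh lvh hbh Cs D) (d.f x)) * (a D x * t x) =
      (∑ C, a D x * hDrev Lh lvh hbh (C :: Cs) D (d.f x) *
        ((starRingEnd ℂ) (d.γ C A x) * t x)) +
      (∑ C, a D x * hDrev Lh lvh hbh [C] D (d.f x) *
        (-((starRingEnd ℂ) (d.γ C A x) * (hTrev Lh hbh Cs (d.f x) * t x)))) := by
      rw [← Finset.sum_add_distrib, Finset.sum_mul]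
      refine Finset.sum_congr rfl fun C _ => ?_
      rw [hDrev_cons C D Cs h1]
      simp only [hDrev]
      ring
    linear_combination e2
  simp_rw [e, Finset.sum_add_distrib]
  rw [Finset.sum_comm]
  congr 2
  rw [Finset.sum_comm]

lemma WW.zero : WW Ω Ωh T L Th Lh lvh hbh k (fun _ _ => 0) :=
  WW.congr _ _ (WW.xi _ (GG.const 0)) (fun d _ x _ => by simp)

lemma WW.sum {ι : Type*} (s : Finset ι) {F : ι → Dat n → (Fin (2 * n + 1) → ℝ) → ℂ}
    (h : ∀ i, WW Ω Ωh T L Th Lh lvh hbh k (F i)) :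
    WW Ω Ωh T L Th Lh lvh hbh k (fun d x => ∑ i ∈ s, F i d x) := by
  classical
  induction s using Finset.induction_on with
  | empty => simpa using WW.zero
  | insert a s ha ih => simpa [Finset.sum_insert ha] using WW.add _ _ (h a) ih

/-- the remainder terms for `γ`. -/
lemma rem_gam (hF : NFrame n Ω T L lv hb) (hFh : NFrame n Ωh Th Lh lvh hbh) (hk : 1 ≤ k)
    (A E : Fin n) (Cs : List (Fin n)) (h1 : 1 ≤ Cs.length) (h2 : Cs.length ≤ k)
    (t : Dat n → (Fin (2 * n + 1) → ℝ) → ℂ) (ht : GG Ω Ωh T L Th Lh k t) :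
    WW Ω Ωh T L Th Lh lvh hbh (k + 1) (fun d x =>
      ((∑ C, ∑ D, d.γ D E x * hDrev Lh lvh hbh [C] D (d.f x) *
        (-((starRingEnd ℂ) (d.γ C A x) * (hTrev Lh hbh Cs (d.f x) * t d x)))) +
      ((∑ D, d.γ D E x * hDrev Lh lvh hbh Cs D (d.f x) * vapp (vconj (L A)) (t d) x) +
      (∑ D, vapp (vconj (L A)) (d.γ D E) x * hDrev Lh lvh hbh Cs D (d.f x) * t d x)))) := by
  refine WW.add _ _ (WW.sum _ fun C => WW.gam [C] (by simp) (by simpa using hk) E _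
    (GG.neg (GG.mul _ _ (GG.cg C A) (GG.mul _ _ (GG.snd (cd_hTrev hFh Cs)) ht.mono))))
    (WW.add _ _ (WW.gam Cs h1 (by omega) E _ (ht.deriv hF hFh hk A)) ?_)
  refine WW.congr _ _ (WW.eta Cs h1 (by omega) _
    (GG.mul _ _ (GG.neg (GG.fst (hF.smooth_lv A E))) ht.mono)) ?_
  intro d hd x hx
  refine Finset.sum_congr rfl fun D _ => ?_
  rw [(rel1 hF hFh hd hx A E).2 D]
  ring

lemma rem_eta (hF : NFrame n Ω T L lv hb) (hFh : NFrame n Ωh Th Lh lvh hbh) (hk : 1 ≤ k)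
    (A : Fin n) (Cs : List (Fin n)) (h1 : 1 ≤ Cs.length) (h2 : Cs.length ≤ k)
    (t : Dat n → (Fin (2 * n + 1) → ℝ) → ℂ) (ht : GG Ω Ωh T L Th Lh k t) :
    WW Ω Ωh T L Th Lh lvh hbh (k + 1) (fun d x =>
      ((∑ C, ∑ D, d.η D x * hDrev Lh lvh hbh [C] D (d.f x) *
        (-((starRingEnd ℂ) (d.γ C A x) * (hTrev Lh hbh Cs (d.f x) * t d x)))) +
      ((∑ D, d.η D x * hDrev Lh lvh hbh Cs D (d.f x) * vapp (vconj (L A)) (t d) x) +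
      (∑ D, vapp (vconj (L A)) (d.η D) x * hDrev Lh lvh hbh Cs D (d.f x) * t d x)))) := by
  refine WW.add _ _ (WW.sum _ fun C => WW.eta [C] (by simp) (by simpa using hk) _
    (GG.neg (GG.mul _ _ (GG.cg C A) (GG.mul _ _ (GG.snd (cd_hTrev hFh Cs)) ht.mono))))
    (WW.add _ _ (WW.eta Cs h1 (by omega) _ (ht.deriv hF hFh hk A)) ?_)
  refine WW.congr _ _ (WW.eta Cs h1 (by omega) _
    (GG.mul _ _ (GG.neg (GG.fst (hF.smooth_hb A))) ht.mono)) ?_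
  intro d hd x hx
  refine Finset.sum_congr rfl fun D _ => ?_
  rw [(rel2 hF hFh hd hx A).2 D]
  ring

lemma smooth_term (hFh : NFrame n Ωh Th Lh lvh hbh)
    (d : Dat n) (hd : Vd Ω Ωh T L Th Lh d) (a : Fin n → (Fin (2 * n + 1) → ℝ) → ℂ)
    (ha : ∀ D, ContDiffOn ℝ (⊤ : ℕ∞) (a D) Ω) (t : (Fin (2 * n + 1) → ℝ) → ℂ)
    (ht : ContDiffOn ℝ (⊤ : ℕ∞) t Ω) (Cs : List (Fin n)) :
    ContDiffOn ℝ (⊤ : ℕ∞) (fun x => ∑ D, a D x * hDrev Lh lvh hbh Cs D (d.f x) * t x) Ω := by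
  refine ContDiffOn.sum fun D _ => ((ha D).mul ?_).mul ht
  exact (cd_hDrev hFh D Cs).comp hd.smooth_f hd.maps

lemma smooth_xi (d : Dat n) (hd : Vd Ω Ωh T L Th Lh d) :
    ContDiffOn ℝ (⊤ : ℕ∞) (fun y => (d.ξ y : ℂ)) Ω :=
  Complex.ofRealCLM.contDiff.comp_contDiffOn hd.smooth_ξ

lemma WW.smooth (hF : NFrame n Ω T L lv hb) (hFh : NFrame n Ωh Th Lh lvh hbh)
    {F : Dat n → (Fin (2 * n + 1) → ℝ) → ℂ} (h : WW Ω Ωh T L Th Lh lvh hbh k F) (d : Dat n)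
    (hd : Vd Ω Ωh T L Th Lh d) : ContDiffOn ℝ (⊤ : ℕ∞) (F d) Ω := by
  induction h with
  | xi s hs => exact (smooth_xi d hd).mul (hs.smooth hF d hd)
  | gam Cs h1 h2 E t ht =>
    exact smooth_term hFh d hd (fun D => d.γ D E) (fun D => hd.smooth_γ D E) (t d)
      (ht.smooth hF d hd) Cs
  | eta Cs h1 h2 t ht =>
    exact smooth_term hFh d hd d.η hd.smooth_η (t d) (ht.smooth hF d hd) Cs
  | add F F' _ _ h h' => exact h.add h'
  | congr F F' _ h' h => exact h.congr (fun x hx => h' d hd x hx)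

lemma WW.deriv (hF : NFrame n Ω T L lv hb) (hFh : NFrame n Ωh Th Lh lvh hbh) (hk : 1 ≤ k)
    (A : Fin n)
    {F : Dat n → (Fin (2 * n + 1) → ℝ) → ℂ} (h : WW Ω Ωh T L Th Lh lvh hbh k F) :
    WW Ω Ωh T L Th Lh lvh hbh (k + 1) (fun d => vapp (vconj (L A)) (F d)) := by
  induction h with
  | xi s hs =>
    refine WW.congr _ _ (WW.add _ _ (WW.xi _ (GG.add _ _ (GG.mul _ _
      (GG.add _ _ (GG.sum Finset.univ fun C => GG.mul _ _ (GG.cg C A) (GG.snd (hFh.smooth_hb C)))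
        (GG.neg (GG.fst (hF.smooth_hb A)))) hs.mono) (hs.deriv hF hFh hk A)))
      (WW.sum Finset.univ fun C => WW.eta [C] (by simp) (by simpa using hk) _
        (GG.mul _ _ (GG.cg C A) hs.mono))) ?_
    intro d hd x hx
    rw [vapp_mul _ (cd_diffAt hF.open_Ω (smooth_xi d hd) hx)
      (cd_diffAt hF.open_Ω (hs.smooth hF d hd) hx), (rel2 hF hFh hd hx A).1]
    simp only [hDrev]
    simp only [← mul_assoc, ← Finset.sum_mul]
    ring
  | gam Cs h1 h2 E t ht =>
    refine WW.congr _ _ (WW.add _ _ (WW.sum Finset.univ fun C =>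
      WW.gam (C :: Cs) (by simp) (by simp; omega) E _ (GG.mul _ _ (GG.cg C A) ht.mono))
      (rem_gam hF hFh hk A E Cs h1 (by omega) t ht)) ?_
    intro d hd x hx
    exact deriv_term hF hFh A d hd (fun D => d.γ D E) (fun D => hd.smooth_γ D E) (t d)
      (ht.smooth hF d hd) Cs h1 hx
  | eta Cs h1 h2 t ht =>
    refine WW.congr _ _ (WW.add _ _ (WW.sum Finset.univ fun C =>
      WW.eta (C :: Cs) (by simp) (by simp; omega) _ (GG.mul _ _ (GG.cg C A) ht.mono))
      (rem_eta hF hFh hk A Cs h1 (by omega) t ht)) ?_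
    intro d hd x hx
    exact deriv_term hF hFh A d hd d.η hd.smooth_η (t d)
      (ht.smooth hF d hd) Cs h1 hx
  | add F F' g g' h h' =>
    refine WW.congr _ _ (WW.add _ _ h h') ?_
    intro d hd x hx
    exact vapp_add _ (cd_diffAt hF.open_Ω (g.smooth hF hFh d hd) hx)
      (cd_diffAt hF.open_Ω (g'.smooth hF hFh d hd) hx)
  | congr F F' _ h' h =>
    refine WW.congr _ _ h ?_
    intro d hd x hx
    exact vapp_congr_on _ hF.open_Ω hx (h' d hd)

lemma WW.neg {F : Dat n → (Fin (2 * n + 1) → ℝ) → ℂ} (h : WW Ω Ωh T L Th Lh lvh hbh k F) :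
    WW Ω Ωh T L Th Lh lvh hbh k (fun d x => - F d x) := by
  induction h with
  | xi s hs => exact WW.congr _ _ (WW.xi _ hs.neg) (fun d _ x _ => by simp)
  | gam Cs h1 h2 E t ht =>
    exact WW.congr _ _ (WW.gam Cs h1 h2 E _ ht.neg) (fun d _ x _ => by simp)
  | eta Cs h1 h2 t ht =>
    exact WW.congr _ _ (WW.eta Cs h1 h2 _ ht.neg) (fun d _ x _ => by simp)
  | add F F' _ _ h h' =>
    exact WW.congr _ _ (WW.add _ _ h h') (fun d _ x _ => by ring)
  | congr F F' _ h' h =>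
    exact WW.congr _ _ h (fun d hd x hx => by rw [h' d hd x hx])

lemma WW.main (hF : NFrame n Ω T L lv hb) (hFh : NFrame n Ωh Th Lh lvh hbh) (B : Fin n)
    (k : ℕ) (hk : 1 ≤ k) : ∀ (As : Fin k → Fin n),
    WW Ω Ωh T L Th Lh lvh hbh k (fun d x => ∑ Cs : Fin k → Fin n, ∑ D,
      d.γ D B x * hDrev Lh lvh hbh (List.ofFn Cs).reverse D (d.f x) *
        ∏ i, (starRingEnd ℂ) (d.γ (Cs i) (As i) x)) := by
  induction k, hk using Nat.le_induction with
  | base =>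
    intro As
    refine WW.congr _ _ (WW.xi _ (GG.fst (hF.smooth_lv (As 0) B))) ?_
    intro d hd x hx
    rw [← (rel1 hF hFh hd hx (As 0) B).1]
    refine Fintype.sum_equiv (Equiv.funUnique (Fin 1) (Fin n)) _ _ fun Cs => ?_
    refine Finset.sum_congr rfl fun D _ => ?_
    simp [hDrev]
    ring
  | succ k hk ih =>
    intro As
    have hG : ∀ Cs : Fin k → Fin n, GG Ω Ωh T L Th Lh k (fun d x =>
        ∏ i, (starRingEnd ℂ) (d.γ (Cs i) (As i.castSucc) x)) := fun Cs =>
      GG.prod Finset.univ fun i => GG.cg _ _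
    refine WW.congr _ _ (WW.add _ _ ((ih (fun i => As i.castSucc)).deriv hF hFh hk (As (Fin.last k)))
      (WW.neg (WW.sum Finset.univ fun Cs : Fin k → Fin n =>
        rem_gam hF hFh hk (As (Fin.last k)) B (List.ofFn Cs).reverse (by simpa using hk) (by simp)
          _ (hG Cs)))) ?_
    intro d hd x hx
    rw [vapp_sum _ _ (fun Cs _ => cd_diffAt hF.open_Ω (smooth_term hFh d hd (fun D => d.γ D B)
      (fun D => hd.smooth_γ D B) _ ((hG Cs).smooth hF d hd) (List.ofFn Cs).reverse) hx),
      ← sub_eq_add_neg, ← Finset.sum_sub_distrib]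
    rw [← (Fin.snocEquiv (fun _ : Fin (k + 1) => Fin n)).sum_comp, Fintype.sum_prod_type_right]
    refine Finset.sum_congr rfl fun Cs _ => ?_
    rw [deriv_term hF hFh (As (Fin.last k)) d hd (fun D => d.γ D B) (fun D => hd.smooth_γ D B)
      _ ((hG Cs).smooth hF d hd) (List.ofFn Cs).reverse (by simpa using hk) hx, add_sub_cancel_right]
    refine Finset.sum_congr rfl fun C _ => Finset.sum_congr rfl fun D _ => ?_
    simp only [Fin.snocEquiv_apply, List.ofFn_succ', Fin.snoc_castSucc, Fin.snoc_last,
      List.concat_eq_append, List.reverse_append, List.reverse_cons, List.reverse_nil,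
      List.nil_append, List.cons_append, Fin.prod_univ_castSucc]
    ring

lemma WW.rep {F : Dat n → (Fin (2 * n + 1) → ℝ) → ℂ} (h : WW Ω Ωh T L Th Lh lvh hbh k F) :
    ∃ (s : MvPolynomial (PolyVarγ n k) (CoefR n))
      (t : (l : ℕ) → (Fin l → Fin n) → Fin n → MvPolynomial (PolyVarγ n k) (CoefR n))
      (u : (l : ℕ) → (Fin l → Fin n) → MvPolynomial (PolyVarγ n k) (CoefR n)),
      SmP Ω Ωh s ∧ (∀ l Cs E, SmP Ω Ωh (t l Cs E)) ∧ (∀ l Cs, SmP Ω Ωh (u l Cs)) ∧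
      ∀ d, Vd Ω Ωh T L Th Lh d → ∀ x ∈ Ω, F d x =
        (d.ξ x : ℂ) * evalγ L d.γ d.f s x
              + (∑ l ∈ Finset.Icc 1 (k - 1), ∑ Cs : Fin l → Fin n, ∑ E, ∑ D,
                  d.γ D E x * hIt Lh lvh hbh (List.ofFn Cs) D (d.f x) *
                    evalγ L d.γ d.f (t l Cs E) x)
              + ∑ l ∈ Finset.Icc 1 (k - 1), ∑ Cs : Fin l → Fin n, ∑ D,
                  d.η D x * hIt Lh lvh hbh (List.ofFn Cs) D (d.f x) *
                    evalγ L d.γ d.f (u l Cs) x := by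
  classical
  have ev0 : ∀ (d : Dat n) x, evalγ L d.γ d.f (0 : MvPolynomial (PolyVarγ n k) (CoefR n)) x = 0 :=
    fun d x => by simp [evalγ]
  have evite : ∀ (d : Dat n) x (p : Prop) [Decidable p] (P : MvPolynomial (PolyVarγ n k) (CoefR n)),
      evalγ L d.γ d.f (if p then P else 0) x = if p then evalγ L d.γ d.f P x else 0 := by
    intro d x p _ P
    split_ifs
    · rfl
    · exact ev0 d x
  induction h with
  | xi s hs =>
    obtain ⟨P, hP, e⟩ := hs.poly
    refine ⟨P, fun _ _ _ => 0, fun _ _ => 0, hP, fun _ _ _ => SmP.zero, fun _ _ => SmP.zero, ?_⟩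
    intro d hd x hx
    simp [ev0, e d hd x hx]
  | gam Cs h1 h2 E t ht =>
    obtain ⟨P, hP, e⟩ := ht.poly
    obtain ⟨l, c, rfl⟩ : ∃ (l : ℕ) (c : Fin l → Fin n), Cs = (List.ofFn c).reverse :=
      ⟨_, Cs.reverse.get, by rw [List.ofFn_get, List.reverse_reverse]⟩
    simp only [List.length_reverse, List.length_ofFn] at h1 h2
    refine ⟨0, fun _ Cs' E' => if List.ofFn Cs' = List.ofFn c ∧ E' = E then P else 0,
      fun _ _ => 0, SmP.zero, fun _ _ _ => hP.ite _, fun _ _ => SmP.zero, ?_⟩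
    intro d hd x hx
    rw [Finset.sum_eq_single l, Finset.sum_eq_single c, Finset.sum_eq_single E]
    · simp [ev0, e d hd x hx, hIt]
    · intro E' _ hE
      simp [ev0, hE]
    · simp
    · intro c' _ hc
      have : List.ofFn c' ≠ List.ofFn c := fun h => hc (List.ofFn_injective h)
      simp [ev0, this]
    · simp
    · intro l' _ hl
      refine Finset.sum_eq_zero fun c' _ => ?_
      have : List.ofFn c' ≠ List.ofFn c := fun h => hl (by simpa using congrArg List.length h)
      simp [ev0, this]
    · intro h
      exact absurd (Finset.mem_Icc.2 ⟨h1, h2⟩) h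
  | eta Cs h1 h2 t ht =>
    obtain ⟨P, hP, e⟩ := ht.poly
    obtain ⟨l, c, rfl⟩ : ∃ (l : ℕ) (c : Fin l → Fin n), Cs = (List.ofFn c).reverse :=
      ⟨_, Cs.reverse.get, by rw [List.ofFn_get, List.reverse_reverse]⟩
    simp only [List.length_reverse, List.length_ofFn] at h1 h2
    refine ⟨0, fun _ _ _ => 0, fun _ Cs' => if List.ofFn Cs' = List.ofFn c then P else 0,
      SmP.zero, fun _ _ _ => SmP.zero, fun _ _ => hP.ite _, ?_⟩
    intro d hd x hx
    simp only [ev0, mul_zero, Finset.sum_const_zero, zero_add]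
    rw [Finset.sum_eq_single l, Finset.sum_eq_single c]
    · simp [e d hd x hx, hIt]
    · intro c' _ hc
      have : List.ofFn c' ≠ List.ofFn c := fun h => hc (List.ofFn_injective h)
      simp [ev0, this]
    · simp
    · intro l' _ hl
      refine Finset.sum_eq_zero fun c' _ => ?_
      have : List.ofFn c' ≠ List.ofFn c := fun h => hl (by simpa using congrArg List.length h)
      simp [ev0, this]
    · intro h
      exact absurd (Finset.mem_Icc.2 ⟨h1, h2⟩) h
  | add F F' _ _ h h' =>
    obtain ⟨s, t, u, hs, ht, hu, e⟩ := h
    obtain ⟨s', t', u', hs', ht', hu', e'⟩ := h'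
    refine ⟨s + s', fun l Cs E => t l Cs E + t' l Cs E, fun l Cs => u l Cs + u' l Cs,
      hs.add hs', fun l Cs E => (ht l Cs E).add (ht' l Cs E),
      fun l Cs => (hu l Cs).add (hu' l Cs), ?_⟩
    intro d hd x hx
    beta_reduce
    rw [e d hd x hx, e' d hd x hx]
    have ea : ∀ P Q : MvPolynomial (PolyVarγ n k) (CoefR n), evalγ L d.γ d.f (P + Q) x =
      evalγ L d.γ d.f P x + evalγ L d.γ d.f Q x := fun P Q => by simp [evalγ]
    simp only [ea, mul_add, Finset.sum_add_distrib]
    ring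
  | congr F F' _ h' h =>
    obtain ⟨s, t, u, hs, ht, hu, e⟩ := h
    exact ⟨s, t, u, hs, ht, hu, fun d hd x hx => by rw [h' d hd x hx, e d hd x hx]⟩

end Main

/-- Lemma 2.20.  For `k ≥ 1` and indices `A₁,…,A_k, B`, there exist
polynomials `r, s, t, u` in the variables `conj(L^J γ^C_A)` (`|J| ≤ k−1`), with coefficients
smooth functions on `Ω × Ω̂` depending only on the two frames (not on `f`), such that the
identity (2.21) holds on `Ω` for every CR diffeomorphism `f` with data `(γ, η, ξ)`. -/
theorem statement12 (n : ℕ) (hn : 1 ≤ n)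
    (Ω Ωh : Set (Fin (2 * n + 1) → ℝ))
    (T : VF (2 * n + 1)) (L : Fin n → VF (2 * n + 1))
    (lv : Fin n → Fin n → (Fin (2 * n + 1) → ℝ) → ℂ)
    (hb : Fin n → (Fin (2 * n + 1) → ℝ) → ℂ)
    (Th : VF (2 * n + 1)) (Lh : Fin n → VF (2 * n + 1))
    (lvh : Fin n → Fin n → (Fin (2 * n + 1) → ℝ) → ℂ)
    (hbh : Fin n → (Fin (2 * n + 1) → ℝ) → ℂ)
    (hF : NFrame n Ω T L lv hb) (hFh : NFrame n Ωh Th Lh lvh hbh)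
    (k : ℕ) (hk : 1 ≤ k) (As : Fin k → Fin n) (B : Fin n) :
    ∃ (r s : MvPolynomial (PolyVarγ n k) (CoefR n))
      (t : (l : ℕ) → (Fin l → Fin n) → Fin n → MvPolynomial (PolyVarγ n k) (CoefR n))
      (u : (l : ℕ) → (Fin l → Fin n) → MvPolynomial (PolyVarγ n k) (CoefR n)),
      (∀ d, ContDiffOn ℝ (⊤ : ℕ∞) (MvPolynomial.coeff d r) (Ω ×ˢ Ωh)) ∧
      (∀ d, ContDiffOn ℝ (⊤ : ℕ∞) (MvPolynomial.coeff d s) (Ω ×ˢ Ωh)) ∧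
      (∀ l Cs E d, ContDiffOn ℝ (⊤ : ℕ∞) (MvPolynomial.coeff d (t l Cs E)) (Ω ×ˢ Ωh)) ∧
      (∀ l Cs d, ContDiffOn ℝ (⊤ : ℕ∞) (MvPolynomial.coeff d (u l Cs)) (Ω ×ˢ Ωh)) ∧
      ∀ (f : (Fin (2 * n + 1) → ℝ) → (Fin (2 * n + 1) → ℝ))
        (γ : Fin n → Fin n → (Fin (2 * n + 1) → ℝ) → ℂ)
        (η : Fin n → (Fin (2 * n + 1) → ℝ) → ℂ)
        (ξ : (Fin (2 * n + 1) → ℝ) → ℝ),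
        CRTrans n Ω Ωh T L Th Lh f γ η ξ →
        ∀ x ∈ Ω,
          (∑ D, ∑ Cs : Fin k → Fin n,
              γ D B x * (∏ i, (starRingEnd ℂ) (γ (Cs i) (As i) x)) *
                hIt Lh lvh hbh (List.ofFn Cs) D (f x)) =
            evalγ L γ f r x + (ξ x : ℂ) * evalγ L γ f s x
              + (∑ l ∈ Finset.Icc 1 (k - 1), ∑ Cs : Fin l → Fin n, ∑ E, ∑ D,
                  γ D E x * hIt Lh lvh hbh (List.ofFn Cs) D (f x) *
                    evalγ L γ f (t l Cs E) x)
              + ∑ l ∈ Finset.Icc 1 (k - 1), ∑ Cs : Fin l → Fin n, ∑ D,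
                  η D x * hIt Lh lvh hbh (List.ofFn Cs) D (f x) *
                    evalγ L γ f (u l Cs) x := by
  obtain ⟨s, t, u, hs, ht, hu, e⟩ := (WW.main hF hFh B k hk As).rep
  refine ⟨0, s, t, u, SmP.zero, hs, ht, hu, ?_⟩
  intro f γ η ξ hC x hx
  have h := e ⟨f, γ, η, ξ⟩ hC x hx
  dsimp only at h
  have e0 : evalγ L γ f (0 : MvPolynomial (PolyVarγ n k) (CoefR n)) x = 0 := by simp [evalγ]
  rw [e0, zero_add, ← h, Finset.sum_comm]
  refine Finset.sum_congr rfl fun Cs _ => Finset.sum_congr rfl fun D _ => ?_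
  simp only [hIt]
  ring
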